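/- arXiv:1903.06365 — 3 statements merged into one kernel-verified Lean document; each statement's English description precedes it below -/
import Mathlib

section
/- Let N ≥ 2, R > 0, 0 < d ≤ 2R, and 0 < Δ ≤ π with cos(Δ/(N−1)) ≤ 1 − d²/(2R²). Let c ∈ ℝ², φ ∈ ℝ, and for j = 1,…,N place pⱼ = c + R(cos(φ+Δⱼ), sin(φ+Δⱼ)) with Δⱼ = Δ(2j−N−1)/(2N−2). Then for all j ≠ l, ‖pⱼ − p_l‖ ≥ d. -/
open Real

/-- `N` defenders placed symmetrically on a circle of radius `R` centered at `c`, at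
angles `φ + Δⱼ` with `Δⱼ = Δ(2j−N−1)/(2N−2)`, are pairwise at distance at least `d`
provided `cos(Δ/(N−1)) ≤ 1 − d²/(2R²)`. -/
theorem formation_pairwise_separation
    (N : ℕ) (hN : 2 ≤ N) (R d Δ : ℝ)
    (hR : 0 < R) (hd0 : 0 < d) (hd2R : d ≤ 2 * R)
    (hΔ0 : 0 < Δ) (hΔπ : Δ ≤ Real.pi)
    (hcos : Real.cos (Δ / ((N : ℝ) - 1)) ≤ 1 - d ^ 2 / (2 * R ^ 2))
    (c : EuclideanSpace ℝ (Fin 2)) (φ : ℝ)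
    (p : ℕ → EuclideanSpace ℝ (Fin 2))
    (hp : ∀ j ∈ Finset.Icc 1 N, p j = c + R •
      (WithLp.equiv 2 (Fin 2 → ℝ)).symm
        ![Real.cos (φ + Δ * (2 * (j : ℝ) - (N : ℝ) - 1) / (2 * (N : ℝ) - 2)),
          Real.sin (φ + Δ * (2 * (j : ℝ) - (N : ℝ) - 1) / (2 * (N : ℝ) - 2))]) :
    ∀ j ∈ Finset.Icc 1 N, ∀ l ∈ Finset.Icc 1 N, j ≠ l → d ≤ ‖p j - p l‖ := by
  intro j hj l hl hjl
  have hNR : (2 : ℝ) ≤ N := by exact_mod_cast hN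
  have hM : (0 : ℝ) < (N : ℝ) - 1 := by linarith
  rw [hp j hj, hp l hl]
  obtain ⟨hj1, hj2⟩ := Finset.mem_Icc.1 hj
  obtain ⟨hl1, hl2⟩ := Finset.mem_Icc.1 hl
  set a := φ + Δ * (2 * (j : ℝ) - (N : ℝ) - 1) / (2 * (N : ℝ) - 2) with ha
  set b := φ + Δ * (2 * (l : ℝ) - (N : ℝ) - 1) / (2 * (N : ℝ) - 2) with hb
  have hab : a - b = Δ / ((N : ℝ) - 1) * ((j : ℝ) - l) := by
    have h2 : 2 * (N : ℝ) - 2 = 2 * ((N : ℝ) - 1) := by ring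
    rw [ha, hb, h2]
    field_simp
    ring
  have hq : 0 < Δ / ((N : ℝ) - 1) := div_pos hΔ0 hM
  have habs : |a - b| = Δ / ((N : ℝ) - 1) * |(j : ℝ) - l| := by
    rw [hab, abs_mul, abs_of_pos hq]
  have h1 : (1 : ℝ) ≤ |(j : ℝ) - l| := by
    have : (1 : ℤ) ≤ |(j : ℤ) - l| := Int.one_le_abs (by omega)
    exact_mod_cast this
  have h2 : |(j : ℝ) - l| ≤ (N : ℝ) - 1 := by
    have e1 : (1 : ℝ) ≤ j := by exact_mod_cast hj1
    have e2 : (j : ℝ) ≤ N := by exact_mod_cast hj2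
    have e3 : (1 : ℝ) ≤ l := by exact_mod_cast hl1
    have e4 : (l : ℝ) ≤ N := by exact_mod_cast hl2
    rw [abs_le]
    constructor <;> linarith
  have hle : |a - b| ≤ Real.pi := by
    rw [habs]
    calc Δ / ((N : ℝ) - 1) * |(j : ℝ) - l| ≤ Δ / ((N : ℝ) - 1) * ((N : ℝ) - 1) := by gcongr
      _ = Δ := by field_simp
      _ ≤ Real.pi := hΔπ
  have hge : Δ / ((N : ℝ) - 1) ≤ |a - b| := by
    rw [habs]
    nlinarith
  have hc : Real.cos (a - b) ≤ 1 - d ^ 2 / (2 * R ^ 2) := by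
    rw [← Real.cos_abs]
    exact (Real.cos_le_cos_of_nonneg_of_le_pi hq.le hle hge).trans hcos
  have hd : d ^ 2 ≤ (1 - Real.cos (a - b)) * (2 * R ^ 2) := by
    rw [← div_le_iff₀ (by positivity)]
    linarith
  rw [EuclideanSpace.norm_eq]
  apply Real.le_sqrt_of_sq_le
  simp [Fin.sum_univ_two]
  rw [Real.cos_sub] at hd
  have sa := Real.sin_sq_add_cos_sq a
  have sb := Real.sin_sq_add_cos_sq b
  have key : (R * Real.cos a - R * Real.cos b) ^ 2 + (R * Real.sin a - R * Real.sin b) ^ 2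
      = (1 - (Real.cos a * Real.cos b + Real.sin a * Real.sin b)) * (2 * R ^ 2) := by
    linear_combination R ^ 2 * sa + R ^ 2 * sb
  rw [key]
  exact hd
end

section
/- Let E be a real inner product space, k > 0, κ ∈ (0, 1), and let x : [0, ∞) → E be a differentiable curve satisfying x′(t) = −k ‖x(t)‖^{κ−1} x(t) whenever x(t) ≠ 0 and x′(t) = 0 whenever x(t) = 0. Then x(t) = 0 for all t ≥ ‖x(0)‖^{1−κ} / (k(1−κ)); i.e. the origin is reached in finite time T ≤ ‖x(0)‖^{1−κ}/(k(1−κ)). -/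
open Real

/-- Finite-time stability of `ẋ = −k ‖x‖^{κ−1} x` (with `ẋ = 0` at the origin) in a real
inner product space: the origin is reached no later than `‖x(0)‖^{1−κ}/(k(1−κ))`. -/
theorem finite_time_stable_origin
    {E : Type*} [NormedAddCommGroup E] [InnerProductSpace ℝ E]
    (k κ : ℝ) (hk : 0 < k) (hκ : κ ∈ Set.Ioo (0 : ℝ) 1)
    (x : ℝ → E)
    (hx : ∀ t, 0 ≤ t →
      (x t ≠ 0 → HasDerivAt x ((-(k * ‖x t‖ ^ (κ - 1))) • x t) t) ∧
      (x t = 0 → HasDerivAt x 0 t)) :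
    ∀ t, ‖x 0‖ ^ (1 - κ) / (k * (1 - κ)) ≤ t → x t = 0 := by
  obtain ⟨hκ0, hκ1⟩ := hκ
  intro t ht
  have hT : 0 ≤ ‖x 0‖ ^ (1 - κ) / (k * (1 - κ)) := by
    have : 0 < 1 - κ := by linarith
    positivity
  have ht0 : 0 ≤ t := hT.trans ht
  by_contra hne
  -- derivative of the squared norm
  have hN : ∀ s, 0 ≤ s → x s ≠ 0 →
      HasDerivAt (fun s => ‖x s‖ ^ 2) (-(2 * k * ‖x s‖ ^ (κ - 1) * ‖x s‖ ^ 2)) s := by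
    intro s hs hxs
    have h := ((hx s hs).1 hxs).norm_sq
    convert h using 1
    rw [inner_smul_right, real_inner_self_eq_norm_sq]
    ring
  have hN' : ∀ s, 0 ≤ s →
      HasDerivAt (fun s => ‖x s‖ ^ 2) (-(2 * k * ‖x s‖ ^ (κ - 1) * ‖x s‖ ^ 2)) s := by
    intro s hs
    by_cases hxs : x s = 0
    · have h := ((hx s hs).2 hxs).norm_sq
      convert h using 1
      simp [hxs]
    · exact hN s hs hxs
  have hanti : AntitoneOn (fun s => ‖x s‖ ^ 2) (Set.Ici 0) := by
    apply antitoneOn_of_hasDerivWithinAt_nonpos (convex_Ici 0)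
      (f' := fun s => -(2 * k * ‖x s‖ ^ (κ - 1) * ‖x s‖ ^ 2))
    · intro s hs
      exact (hN' s hs).continuousAt.continuousWithinAt
    · intro s hs
      exact (hN' s (interior_subset hs)).hasDerivWithinAt
    · intro s _
      have : 0 ≤ 2 * k * ‖x s‖ ^ (κ - 1) * ‖x s‖ ^ 2 := by positivity
      linarith
  have hnz : ∀ s ∈ Set.Icc 0 t, x s ≠ 0 := by
    intro s hs h0
    have h : ‖x t‖ ^ 2 ≤ ‖x s‖ ^ 2 := hanti (Set.mem_Ici.2 hs.1) (Set.mem_Ici.2 ht0) hs.2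
    rw [h0] at h
    have : 0 < ‖x t‖ := norm_pos_iff.2 hne
    simp at h
    exact hne h
  have hpow : ∀ s, (‖x s‖ ^ 2) ^ ((1 - κ) / 2) = ‖x s‖ ^ (1 - κ) := by
    intro s
    rw [← Real.rpow_natCast, ← Real.rpow_mul (norm_nonneg _)]
    congr 1
    push_cast
    ring
  have hg : ∀ s ∈ Set.Icc 0 t,
      HasDerivAt (fun s => (‖x s‖ ^ 2) ^ ((1 - κ) / 2) + k * (1 - κ) * s) 0 s := by
    intro s hs
    have hpos : 0 < ‖x s‖ := norm_pos_iff.2 (hnz s hs)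
    have h1 := (hN' s hs.1).rpow_const (p := (1 - κ) / 2) (Or.inl (by positivity))
    have h2 := h1.add ((hasDerivAt_id s).const_mul (k * (1 - κ)))
    refine HasDerivAt.congr_deriv h2 ?_
    have e : ‖x s‖ ^ (κ - 1) * ‖x s‖ ^ 2 * (‖x s‖ ^ 2) ^ ((1 - κ) / 2 - 1) = 1 := by
      rw [← Real.rpow_natCast, ← Real.rpow_mul hpos.le, ← Real.rpow_add hpos,
        ← Real.rpow_add hpos]
      convert Real.rpow_zero _ using 2
      push_cast
      ring
    linear_combination -(k * (1 - κ)) * e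
  have hganti : AntitoneOn (fun s => (‖x s‖ ^ 2) ^ ((1 - κ) / 2) + k * (1 - κ) * s)
      (Set.Icc 0 t) := by
    apply antitoneOn_of_hasDerivWithinAt_nonpos (convex_Icc 0 t) (f' := fun _ => 0)
    · intro s hs
      exact (hg s hs).continuousAt.continuousWithinAt
    · intro s hs
      exact (hg s (interior_subset hs)).hasDerivWithinAt
    · intro s _
      exact le_rfl
  have hfin := hganti (Set.left_mem_Icc.2 ht0) (Set.right_mem_Icc.2 ht0) ht0
  simp only [hpow] at hfin
  have hpos : 0 < ‖x t‖ ^ (1 - κ) := Real.rpow_pos_of_pos (norm_pos_iff.2 hne) _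
  have hk1 : 0 < k * (1 - κ) := mul_pos hk (by linarith)
  rw [div_le_iff₀ hk1] at ht
  linarith
end

section
/- Let k > 0 and ε > 0. Let v : [0, ∞) → ℝ be differentiable with v(0) > ε and v′(t) ≤ −k·tanh(v(t)) for all t with v(t) ≥ ε. Then v(t) ≤ ε for all t ≥ (v(0) − ε)/(k·tanh ε). -/
open Real

lemma aux_tanh_lt {a b : ℝ} (h : a < b) : Real.tanh a < Real.tanh b := by
  rw [Real.tanh_eq_sinh_div_cosh, Real.tanh_eq_sinh_div_cosh,
    div_lt_div_iff₀ (Real.cosh_pos a) (Real.cosh_pos b)]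
  have h1 : 0 < Real.sinh (b - a) := Real.sinh_pos_iff.mpr (by linarith)
  rw [Real.sinh_sub] at h1
  linarith

/-- Reaching-phase estimate: if `v` is differentiable on `[0, ∞)` with `v(0) > ε` and
`v′ ≤ −k tanh(v)` whenever `v ≥ ε`, then `v(t) ≤ ε` for all
`t ≥ (v(0) − ε)/(k tanh ε)`. -/
theorem reaching_phase_estimate
    (k ε : ℝ) (hk : 0 < k) (hε : 0 < ε)
    (v v' : ℝ → ℝ) (hv0 : ε < v 0)
    (hvderiv : ∀ t, 0 ≤ t → HasDerivWithinAt v (v' t) (Set.Ici 0) t)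
    (hdecay : ∀ t, 0 ≤ t → ε ≤ v t → v' t ≤ -k * Real.tanh (v t)) :
    ∀ t, (v 0 - ε) / (k * Real.tanh ε) ≤ t → v t ≤ ε := by
  intro t ht
  have htanh : 0 < Real.tanh ε := by simpa using aux_tanh_lt hε
  set c := k * Real.tanh ε with hc
  have hcpos : 0 < c := mul_pos hk htanh
  set T := (v 0 - ε) / c with hT
  have hTpos : 0 < T := div_pos (by linarith) hcpos
  have hcT : c * T = v 0 - ε := by rw [hT]; field_simp
  have hcont : ∀ a b : ℝ, 0 ≤ a → ContinuousOn v (Set.Icc a b) := fun a b ha x hx =>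
    ((hvderiv x (ha.trans hx.1)).continuousWithinAt).mono fun y hy => ha.trans hy.1
  have hder : ∀ x : ℝ, 0 ≤ x → HasDerivWithinAt v (v' x) (Set.Ici x) x := fun x hx =>
    (hvderiv x hx).mono (Set.Ici_subset_Ici.mpr hx)
  have hBd : ∀ x : ℝ, HasDerivAt (fun x => v 0 - c * x) (-c) x := fun x => by
    simpa using ((hasDerivAt_id x).const_mul c).const_sub (v 0)
  have hvT : v T ≤ ε := by
    have := image_le_of_deriv_right_lt_deriv_boundary' (f := v) (f' := v') (a := 0) (b := T)
      (B := fun x => v 0 - c * x) (B' := fun _ => -c)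
      (hcont 0 T le_rfl) (fun x hx => hder x hx.1) (by simp) (by fun_prop)
      (fun x _ => (hBd x).hasDerivWithinAt)
      (fun x hx hxe => by
        have h1 : c * x < c * T := mul_lt_mul_of_pos_left hx.2 hcpos
        have h2 : ε < v x := by linarith
        have h3 := hdecay x hx.1 h2.le
        have h4 := mul_lt_mul_of_pos_left (aux_tanh_lt h2) hk
        linarith)
      (Set.right_mem_Icc.mpr hTpos.le)
    linarith
  exact image_le_of_deriv_right_lt_deriv_boundary' (f := v) (f' := v') (a := T) (b := t)
      (B := fun _ => ε) (B' := fun _ => 0)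
      (hcont T t hTpos.le) (fun x hx => hder x (hTpos.le.trans hx.1)) hvT (by fun_prop)
      (fun x _ => hasDerivWithinAt_const _ _ _)
      (fun x hx hxe => by
        have h3 := hdecay x (hTpos.le.trans hx.1) (ge_of_eq hxe)
        rw [hxe] at h3
        linarith)
      (Set.right_mem_Icc.mpr ht)
end
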